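/- arXiv:1707.09748 — 2 statements merged into one kernel-verified Lean document; each statement's English description precedes it below -/
import Mathlib

section
/- Let n ≥ 2, let M' be an n×n complex matrix, set M = diag(M', 1) of size (n+1)×(n+1), let G be the (n+1)×(n+1) matrix equal to the identity except that its trailing 2×2 principal submatrix (rows and columns n, n+1) equals [α, β; γ, δ], and let A, D be arbitrary diagonal (n+1)×(n+1) complex matrices. Then det(A·G·M + D) = det(A·M·G + D); consequently A·G·M + D and A·M·G + D have the same characteristic polynomial and the same eigenvalues. -/
noncomputable section

open Matrix

theorem aux_scale (m : ℕ) (K N : Matrix (Fin (m+1)) (Fin (m+1)) ℂ) (x y d : ℂ)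
    (h1 : ∀ i j : Fin m, N i.castSucc j.castSucc = K i.castSucc j.castSucc)
    (h2 : ∀ i : Fin m, N i.castSucc (Fin.last m) = x * K i.castSucc (Fin.last m))
    (h3 : ∀ j : Fin m, N (Fin.last m) j.castSucc = y * K (Fin.last m) j.castSucc)
    (h4 : N (Fin.last m) (Fin.last m) = x * y * K (Fin.last m) (Fin.last m) + d) :
    N.det = x * y * K.det + d * (K.submatrix Fin.castSucc Fin.castSucc).det := by
  classical
  set L : Matrix (Fin (m+1)) (Fin (m+1)) ℂ :=
    diagonal (fun i => if i = Fin.last m then y else 1) * K *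
      diagonal (fun i => if i = Fin.last m then x else 1) with hL
  have hprod : ∀ z : ℂ, ∏ i : Fin (m+1), (if i = Fin.last m then z else 1) = z := by
    intro z; simp
  have hLdet : L.det = x * y * K.det := by
    rw [hL, det_mul, det_mul, det_diagonal, det_diagonal, hprod, hprod]; ring
  have hNL : N = L.updateRow (Fin.last m) (L (Fin.last m) + d • Pi.single (Fin.last m) 1) := by
    ext i j
    refine Fin.lastCases ?_ (fun i => ?_) i <;> refine Fin.lastCases ?_ (fun j => ?_) j
    · simp [hL, h4]; ring
    · simp [hL, h3, Fin.castSucc_ne_last]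
    · simp [hL, h2, updateRow_apply, Fin.castSucc_ne_last]; ring
    · simp [hL, h1, updateRow_apply, Fin.castSucc_ne_last]
  rw [hNL, det_updateRow_add, det_updateRow_smul, updateRow_eq_self, hLdet,
    ← adjugate_apply, adjugate_fin_succ_eq_det_submatrix]
  have : L.submatrix (Fin.last m).succAbove (Fin.last m).succAbove
      = K.submatrix Fin.castSucc Fin.castSucc := by
    ext i j
    simp [hL, Fin.castSucc_ne_last]
  rw [this]
  simp [← two_mul, pow_mul]

theorem aux_col (m : ℕ) (N : Matrix (Fin (m+2)) (Fin (m+2)) ℂ)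
    (h : ∀ i : Fin m, N i.castSucc.castSucc (Fin.last (m+1)) = 0) :
    N.det = N (Fin.last _) (Fin.last _) * (N.submatrix Fin.castSucc Fin.castSucc).det
      - N (Fin.last m).castSucc (Fin.last _) *
        (N.submatrix (Fin.last m).castSucc.succAbove Fin.castSucc).det := by
  rw [det_succ_column N (Fin.last _), Fin.sum_univ_castSucc, Fin.sum_univ_castSucc]
  have e : (-1 : ℂ) ^ (m + (m+1)) = -1 := by
    rw [show m + (m+1) = 2*m+1 by ring, pow_succ, pow_mul]; simp
  have e2 : (-1 : ℂ) ^ ((m+1) + (m+1)) = 1 := by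
    rw [show (m+1) + (m+1) = 2*(m+1) by ring, pow_mul]; simp
  simp only [h, mul_zero, zero_mul, Finset.sum_const_zero, Fin.val_castSucc, Fin.val_last, e, e2,
    Fin.succAbove_last]
  ring

theorem aux_core (m : ℕ)
    (M G : Matrix (Fin (m + 2)) (Fin (m + 2)) ℂ)
    (hM1 : M (Fin.last _) (Fin.last _) = 1)
    (hMrow : ∀ i : Fin (m + 1), M i.castSucc (Fin.last _) = 0)
    (hMcol : ∀ j : Fin (m + 1), M (Fin.last _) j.castSucc = 0)
    (hG : ∀ i j : Fin (m + 2), ((i : ℕ) < m ∨ (j : ℕ) < m) →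
      G i j = if i = j then 1 else 0)
    (a d : Fin (m+2) → ℂ) :
    (diagonal a * G * M + diagonal d).det = (diagonal a * M * G + diagonal d).det := by
  have g1 : ∀ i j : Fin m, G i.castSucc.castSucc j.castSucc.castSucc = if i = j then 1 else 0 := by
    intro i j; rw [hG _ _ (by simp)]; simp
  have g2 : ∀ (i : Fin m), G i.castSucc.castSucc (Fin.last m).castSucc = 0 := by
    intro i; rw [hG _ _ (by simp)]; simp [Fin.castSucc_ne_last]
  have g3 : ∀ (i : Fin m), G i.castSucc.castSucc (Fin.last _) = 0 := by
    intro i; rw [hG _ _ (by simp)]; simp [Fin.castSucc_ne_last]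
  have g4 : ∀ (i : Fin m), G (Fin.last m).castSucc i.castSucc.castSucc = 0 := by
    intro i; rw [hG _ _ (by simp)]; simp [(Fin.castSucc_ne_last _).symm]
  have g5 : ∀ (i : Fin m), G (Fin.last _) i.castSucc.castSucc = 0 := by
    intro i; rw [hG _ _ (by simp)]; simp [(Fin.castSucc_ne_last _).symm]
  set p := (Fin.last m).castSucc with hp
  set l := Fin.last (m+1) with hl
  have s1 : ∀ i : Fin m, p.succAbove i.castSucc = i.castSucc.castSucc := by
    intro i; rw [hp, Fin.succAbove_of_castSucc_lt]; simp [Fin.lt_def]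
  have s2 : p.succAbove (Fin.last m) = l := by
    rw [hp, Fin.succAbove_of_le_castSucc]
    · simp [hl]
    · simp
  have npl : p ≠ l := by simp [hp, hl, Fin.castSucc_ne_last]
  have nip : ∀ i : Fin m, i.castSucc.castSucc ≠ p := by simp [hp, Fin.castSucc_ne_last]
  have nil : ∀ i : Fin m, i.castSucc.castSucc ≠ l := by simp [hl, Fin.castSucc_ne_last]
  have r1 : ∀ i : Fin m, M i.castSucc.castSucc l = 0 := fun i => hMrow _
  have r2 : M p l = 0 := hMrow _
  have c1 : ∀ i : Fin m, M l i.castSucc.castSucc = 0 := fun i => hMcol _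
  have c2 : M l p = 0 := hMcol _
  set P := diagonal a * G * M + diagonal d with hP
  set Q := diagonal a * M * G + diagonal d with hQ
  have P0 : ∀ i j, P i j = a i * ∑ k, G i k * M k j + diagonal d i j := by
    intro i j; rw [hP, Matrix.mul_assoc, Matrix.add_apply, diagonal_mul, mul_apply]
  have Q0 : ∀ i j, Q i j = a i * ∑ k, M i k * G k j + diagonal d i j := by
    intro i j; rw [hQ, Matrix.mul_assoc, Matrix.add_apply, diagonal_mul, mul_apply]
  simp only [Fin.sum_univ_castSucc, ← hp, ← hl] at P0 Q0
  -- the basic matrix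
  set K : Matrix (Fin (m+1)) (Fin (m+1)) ℂ := fun i j =>
    if i = Fin.last m then M i.castSucc j.castSucc
    else a i.castSucc * M i.castSucc j.castSucc +
      (if i = j then d i.castSucc else 0) with hK
  have k1 : ∀ i j : Fin m, K i.castSucc j.castSucc = a i.castSucc.castSucc *
      M i.castSucc.castSucc j.castSucc.castSucc + if i = j then d i.castSucc.castSucc else 0 := by
    intro i j; simp [hK, Fin.castSucc_ne_last]
  have k2 : ∀ i : Fin m, K i.castSucc (Fin.last m) = a i.castSucc.castSucc *
      M i.castSucc.castSucc p := by
    intro i; simp [hK, Fin.castSucc_ne_last, hp]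
  have k3 : ∀ j : Fin m, K (Fin.last m) j.castSucc = M p j.castSucc.castSucc := by
    intro i; simp [hK, hp]
  have k4 : K (Fin.last m) (Fin.last m) = M p p := by simp [hK, hp]
  clear_value K P Q
  have hPc : ∀ i : Fin m, P i.castSucc.castSucc l = 0 := by
    intro i; simp [P0, g1, g2, g3, r1, r2, nil]
  have hQc : ∀ i : Fin m, Qᵀ i.castSucc.castSucc l = 0 := by
    intro i; simp [Q0, g1, g5, g4, c1, c2, (nil _).symm]
  rw [← det_transpose Q, aux_col m P hPc, aux_col m Qᵀ hQc]
  rw [aux_scale m K (P.submatrix Fin.castSucc Fin.castSucc) 1 (a p * G p p) (d p),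
    aux_scale m K (P.submatrix p.succAbove Fin.castSucc) 1 (a l * G l p) 0,
    ← det_transpose (Qᵀ.submatrix Fin.castSucc Fin.castSucc),
    ← det_transpose (Qᵀ.submatrix p.succAbove Fin.castSucc),
    aux_scale m K (Qᵀ.submatrix Fin.castSucc Fin.castSucc)ᵀ (G p p) (a p) (d p),
    aux_scale m K (Qᵀ.submatrix p.succAbove Fin.castSucc)ᵀ (G p l) (a p) 0]
  · simp [P0, Q0, g3, g5, r1, r2, c1, c2, hM1, ← hp, ← hl, npl, npl.symm]
    ring
  all_goals
    intros
    simp [P0, Q0, s1, s2, g1, g2, g3, g4, g5, r1, r2, c1, c2, k1, k2, k3, k4, ← hp, npl, npl.symm,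
      nip, nil, fun i => (nip i).symm, fun i => (nil i).symm, diagonal_apply]
    try ring

/-- Lemma `lemAMPD2`: let M' be an n×n complex matrix (n ≥ 2),
M = diag(M',1) of size (n+1)×(n+1), G the identity matrix except possibly for its
trailing 2×2 principal submatrix (rows and columns n, n+1, i.e. 0-based indices
n−1, n), and A, D arbitrary diagonal matrices.  Then
det(A·G·M + D) = det(A·M·G + D); consequently A·G·M + D and A·M·G + D have the
same characteristic polynomial and the same eigenvalues. -/
theorem stmt16 (n : ℕ) (hn : 2 ≤ n)
    (M : Matrix (Fin (n + 1)) (Fin (n + 1)) ℂ)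
    (hM1 : M (Fin.last n) (Fin.last n) = 1)
    (hMrow : ∀ i : Fin (n + 1), i ≠ Fin.last n → M i (Fin.last n) = 0)
    (hMcol : ∀ j : Fin (n + 1), j ≠ Fin.last n → M (Fin.last n) j = 0)
    (G : Matrix (Fin (n + 1)) (Fin (n + 1)) ℂ)
    (hG : ∀ i j : Fin (n + 1), ((i : ℕ) < n - 1 ∨ (j : ℕ) < n - 1) →
      G i j = if i = j then 1 else 0)
    (A D : Matrix (Fin (n + 1)) (Fin (n + 1)) ℂ) (hA : A.IsDiag) (hD : D.IsDiag) :
    (A * G * M + D).det = (A * M * G + D).det ∧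
    (A * G * M + D).charpoly = (A * M * G + D).charpoly ∧
    ∀ lam : ℂ, ((A * G * M + D - lam • 1).det = 0 ↔ (A * M * G + D - lam • 1).det = 0) := by
  obtain ⟨m, rfl⟩ : ∃ m, n = m + 1 := ⟨n - 1, by omega⟩
  have core : ∀ a d : Fin (m+2) → ℂ,
      (diagonal a * G * M + diagonal d).det = (diagonal a * M * G + diagonal d).det :=
    aux_core m M G hM1 (fun i => hMrow _ (Fin.castSucc_ne_last i))
      (fun i => hMcol _ (Fin.castSucc_ne_last i)) (by simpa using hG)
  obtain ⟨a, rfl⟩ : ∃ a, A = diagonal a := ⟨A.diag, hA.diagonal_diag.symm⟩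
  obtain ⟨d, rfl⟩ : ∃ d, D = diagonal d := ⟨D.diag, hD.diagonal_diag.symm⟩
  refine ⟨core a d, ?_, ?_⟩
  · apply Polynomial.funext
    intro t
    rw [eval_charpoly, eval_charpoly]
    have key : ∀ X : Matrix (Fin (m+2)) (Fin (m+2)) ℂ,
        scalar (Fin (m+2)) t - (diagonal a * X + diagonal d)
          = diagonal (-a) * X + diagonal (fun i => t - d i) := by
      intro X
      ext i j
      by_cases h : i = j
      · subst h; simp; ring
      · simp [h]
    rw [Matrix.mul_assoc, Matrix.mul_assoc, key, key, ← Matrix.mul_assoc, ← Matrix.mul_assoc, core]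
  · intro t
    have key : ∀ X : Matrix (Fin (m+2)) (Fin (m+2)) ℂ,
        X + diagonal d - t • (1 : Matrix (Fin (m+2)) (Fin (m+2)) ℂ)
          = X + diagonal (fun i => d i - t) := by
      intro X
      ext i j
      by_cases h : i = j
      · subst h; simp; ring
      · simp [h]
    rw [key, key, core]
end
end

section
/- Let π be an arbitrary permutation of (1, …, n), let M_π = ∏_{i∈π} G_i with each G_i a G-matrix of size (n+1)×(n+1), let A and D be arbitrary diagonal (n+1)×(n+1) complex matrices, and let P be the n×(n+1) projection matrix [I_n, 0] deleting the last coordinate. Then det(P(A·M_π + D)P^*) does not depend on the permutation π. -/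
noncomputable section

open Matrix

/-- A G-matrix of size (n+1)×(n+1) with block index k (0-based rows/columns k, k+1):
it equals the identity matrix outside of the 2×2 submatrix in rows and columns k, k+1. -/
def IsGMat {n : ℕ} (k : Fin n) (G : Matrix (Fin (n + 1)) (Fin (n + 1)) ℂ) : Prop :=
  ∀ i j : Fin (n + 1),
    ¬((i = k.castSucc ∨ i = k.succ) ∧ (j = k.castSucc ∨ j = k.succ)) →
    G i j = if i = j then 1 else 0

/-- M_π = G_{π(1)}·G_{π(2)}·⋯·G_{π(n)}, the product taken from left to right in the
order prescribed by the permutation π. -/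
def Mperm {n : ℕ} (G : Fin n → Matrix (Fin (n + 1)) (Fin (n + 1)) ℂ)
    (π : Equiv.Perm (Fin n)) : Matrix (Fin (n + 1)) (Fin (n + 1)) ℂ :=
  (List.ofFn (fun i : Fin n => G (π i))).prod

/-- the n×(n+1) projection matrix P = [I_n 0] deleting the last coordinate -/
def Pproj (n : ℕ) : Matrix (Fin n) (Fin (n + 1)) ℂ :=
  Matrix.of fun i j => if (j : ℕ) = (i : ℕ) then 1 else 0

/-- Two-sided truncation to the principal block S, completed by the identity. -/
def QT {n : ℕ} (S : Finset (Fin (n + 1))) (M : Matrix (Fin (n + 1)) (Fin (n + 1)) ℂ) :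
    Matrix (Fin (n + 1)) (Fin (n + 1)) ℂ :=
  Matrix.of fun i j => if i ∈ S ∧ j ∈ S then M i j else if i = j then 1 else 0

/-- Row q and column q of M agree with the identity. -/
def FixQ {n : ℕ} (q : Fin (n + 1)) (M : Matrix (Fin (n + 1)) (Fin (n + 1)) ℂ) : Prop :=
  (∀ i, M i q = if i = q then 1 else 0) ∧ (∀ i, M q i = if q = i then 1 else 0)

lemma FixQ.one {n : ℕ} (q : Fin (n + 1)) : FixQ q 1 := by
  constructor <;> intro i <;> simp [Matrix.one_apply]

lemma FixQ.mul {n : ℕ} {q : Fin (n + 1)} {M N : Matrix (Fin (n + 1)) (Fin (n + 1)) ℂ}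
    (hM : FixQ q M) (hN : FixQ q N) : FixQ q (M * N) := by
  constructor
  · intro i
    simp [Matrix.mul_apply, hN.1, hM.1]
  · intro i
    simp [Matrix.mul_apply, hM.2, hN.2]

lemma det_of_row {n : ℕ} (q : Fin (n + 1)) (A B : Matrix (Fin (n + 1)) (Fin (n + 1)) ℂ) (δ : ℂ)
    (hA : ∀ j, A q j = if q = j then δ else 0) (hB : ∀ j, B q j = if q = j then 1 else 0)
    (hAB : ∀ i j, i ≠ q → j ≠ q → A i j = B i j) : A.det = δ * B.det := by
  rw [Matrix.det_succ_row A q, Matrix.det_succ_row B q]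
  rw [Finset.sum_eq_single q, Finset.sum_eq_single q]
  · have : A.submatrix q.succAbove q.succAbove = B.submatrix q.succAbove q.succAbove := by
      ext i j
      exact hAB _ _ (Fin.succAbove_ne q i) (Fin.succAbove_ne q j)
    rw [this, hA, hB]
    simp
  · intro b _ hb
    simp [hB, hb.symm]
  · simp
  · intro b _ hb
    simp [hA, hb.symm]
  · simp

lemma QT_transpose {n : ℕ} (S : Finset (Fin (n + 1)))
    (M : Matrix (Fin (n + 1)) (Fin (n + 1)) ℂ) : QT S Mᵀ = (QT S M)ᵀ := by
  ext i j
  simp only [QT, Matrix.of_apply, Matrix.transpose_apply, and_comm, eq_comm]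

lemma QT_mul {n : ℕ} (S : Finset (Fin (n + 1))) (k : Fin n)
    (M G : Matrix (Fin (n + 1)) (Fin (n + 1)) ℂ) (hG : IsGMat k G) (hM : FixQ k.succ M) :
    (QT S (M * G)).det = (QT S M).det * (QT S G).det := by
  have hpq : k.castSucc ≠ k.succ := (Fin.castSucc_lt_succ).ne
  by_cases hc : k.castSucc ∉ S ∧ k.succ ∈ S
  · obtain ⟨hp, hq⟩ := hc
    have hne : ∀ j ∈ S, j ≠ k.castSucc := fun j hj h => hp (h ▸ hj)
    have h1 : (QT S (M * G)).det = G k.succ k.succ * (QT S M).det := by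
      apply det_of_row k.succ
      · intro j
        simp only [QT, Matrix.of_apply, Matrix.mul_apply, hM.2, hq, true_and]
        by_cases hj : j ∈ S
        · simp only [hj, if_true, ite_mul, one_mul, zero_mul, Finset.sum_ite_eq, Finset.mem_univ]
          by_cases h : k.succ = j
          · simp [← h]
          · rw [hG _ _ (by rintro ⟨_, h' | h'⟩; exacts [hne j hj h', h h'.symm])]
            simp [h]
        · have : k.succ ≠ j := fun h => hj (h ▸ hq)
          simp [hj, this]
      · intro j
        simp only [QT, Matrix.of_apply, hM.2, hq, true_and, ite_self]
      · intro i j hi hj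
        simp only [QT, Matrix.of_apply]
        by_cases h : i ∈ S ∧ j ∈ S
        · simp only [h, and_self, if_true, Matrix.mul_apply]
          rw [Finset.sum_eq_single j]
          · rw [hG _ _ (by rintro ⟨_, h' | h'⟩; exacts [hne j h.2 h', hj h'])]
            simp
          · intro b _ hb
            rw [hG _ _ (by rintro ⟨_, h' | h'⟩; exacts [hne j h.2 h', hj h'])]
            simp [hb]
          · simp
        · simp [h]
    have h2 : (QT S G).det = G k.succ k.succ * (1 : Matrix (Fin (n + 1)) (Fin (n + 1)) ℂ).det := by
      apply det_of_row k.succ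
      · intro j
        simp only [QT, Matrix.of_apply, hq, true_and]
        by_cases hj : j ∈ S
        · by_cases h : k.succ = j
          · simp [← h, hq]
          · rw [hG _ _ (by rintro ⟨_, h' | h'⟩; exacts [hne j hj h', h h'.symm])]
            simp [h]
        · have : k.succ ≠ j := fun h => hj (h ▸ hq)
          simp [hj, this]
      · intro j
        simp [Matrix.one_apply]
      · intro i j hi hj
        simp only [QT, Matrix.of_apply, Matrix.one_apply]
        by_cases h : i ∈ S ∧ j ∈ S
        · rw [hG _ _ (by rintro ⟨_, h' | h'⟩; exacts [hne j h.2 h', hj h'])]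
          simp
        · simp [h]
    rw [h1, h2, Matrix.det_one]
    ring
  · rw [← Matrix.det_mul]
    congr 1
    ext i j
    simp only [QT, Matrix.of_apply, Matrix.mul_apply]
    by_cases hi : i ∈ S
    · by_cases hj : j ∈ S
      · simp only [hi, hj, and_self, if_true, true_and, and_true]
        apply Finset.sum_congr rfl
        intro t _
        by_cases ht : t ∈ S
        · simp [ht]
        · have htj : t ≠ j := fun h => ht (h ▸ hj)
          have hit : i ≠ t := fun h => ht (h ▸ hi)
          simp only [ht, if_false, htj, mul_zero]
          by_cases hG0 : (t = k.castSucc ∨ t = k.succ) ∧ (j = k.castSucc ∨ j = k.succ)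
          · have : t = k.succ := by
              rcases hG0 with ⟨h1 | h1, h2 | h2⟩
              · exact absurd (h1.trans h2.symm) htj
              · exact absurd ⟨h1 ▸ ht, h2 ▸ hj⟩ hc
              · exact h1
              · exact h1
            subst this
            rw [hM.1, if_neg hit, zero_mul]
          · rw [hG _ _ hG0, if_neg htj, mul_zero]
      · have hij : i ≠ j := fun h => hj (h ▸ hi)
        simp only [hi, hj, and_false, if_false, hij, true_and]
        symm
        apply Finset.sum_eq_zero
        intro t _
        by_cases htj : t = j
        · subst htj; simp [hj, hij]
        · simp [htj]
    · simp only [hi, false_and, if_false, ite_mul, one_mul, zero_mul, Finset.sum_ite_eq,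
        Finset.mem_univ, if_true]

lemma FixQ.transpose {n : ℕ} {q : Fin (n + 1)} {M : Matrix (Fin (n + 1)) (Fin (n + 1)) ℂ}
    (hM : FixQ q M) : FixQ q Mᵀ := by
  refine ⟨fun i => ?_, fun i => ?_⟩
  · rw [Matrix.transpose_apply, hM.2]; simp only [eq_comm]
  · rw [Matrix.transpose_apply, hM.1]; simp only [eq_comm]

lemma IsGMat.transpose {n : ℕ} {k : Fin n} {G : Matrix (Fin (n + 1)) (Fin (n + 1)) ℂ}
    (hG : IsGMat k G) : IsGMat k Gᵀ := by
  intro i j h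
  rw [Matrix.transpose_apply, hG j i (fun h' => h ⟨h'.2, h'.1⟩)]
  simp only [eq_comm]

lemma QT_mul' {n : ℕ} (S : Finset (Fin (n + 1))) (k : Fin n)
    (M G : Matrix (Fin (n + 1)) (Fin (n + 1)) ℂ) (hG : IsGMat k G) (hM : FixQ k.succ M) :
    (QT S (G * M)).det = (QT S M).det * (QT S G).det := by
  have := QT_mul S k Mᵀ Gᵀ hG.transpose hM.transpose
  rwa [← Matrix.transpose_mul, QT_transpose, QT_transpose, QT_transpose, Matrix.det_transpose,
    Matrix.det_transpose, Matrix.det_transpose] at this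

lemma IsGMat.fixQ {n : ℕ} {k : Fin n} {G : Matrix (Fin (n + 1)) (Fin (n + 1)) ℂ}
    (hG : IsGMat k G) (m : Fin n) (h : k < m) : FixQ m.succ G := by
  have h1 : m.succ ≠ k.castSucc := by
    intro h'; rw [Fin.lt_def] at h; simp [Fin.ext_iff] at h'; omega
  have h2 : m.succ ≠ k.succ := by
    intro h'; rw [Fin.lt_def] at h; simp [Fin.ext_iff] at h'; omega
  constructor
  · intro i
    exact hG _ _ (by rintro ⟨_, h | h⟩ <;> contradiction)
  · intro i
    exact hG _ _ (by rintro ⟨h | h, _⟩ <;> contradiction)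

lemma gmul_zero {n : ℕ} {k m : Fin n} {G H : Matrix (Fin (n + 1)) (Fin (n + 1)) ℂ}
    (hG : IsGMat k G) (hH : IsGMat m H)
    (h : ∀ t : Fin (n + 1), ¬ ((t = k.castSucc ∨ t = k.succ) ∧ (t = m.castSucc ∨ t = m.succ))) :
    (G - 1) * (H - 1) = 0 := by
  ext i j
  rw [Matrix.mul_apply]
  apply Finset.sum_eq_zero
  intro t _
  by_cases ht : t = k.castSucc ∨ t = k.succ
  · have : (H - 1) t j = 0 := by
      rw [Matrix.sub_apply, hH _ _ (fun h' => h t ⟨ht, h'.1⟩), Matrix.one_apply, sub_self]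
    rw [this, mul_zero]
  · have : (G - 1) i t = 0 := by
      rw [Matrix.sub_apply, hG _ _ (fun h' => ht h'.2), Matrix.one_apply, sub_self]
    rw [this, zero_mul]

lemma gcommute {n : ℕ} {k m : Fin n} {G H : Matrix (Fin (n + 1)) (Fin (n + 1)) ℂ}
    (hG : IsGMat k G) (hH : IsGMat m H) (hkm : (k : ℕ) + 1 < m) : Commute G H := by
  have hd : ∀ t : Fin (n + 1),
      ¬ ((t = k.castSucc ∨ t = k.succ) ∧ (t = m.castSucc ∨ t = m.succ)) := by
    rintro t ⟨h1 | h1, h2 | h2⟩ <;> simp [Fin.ext_iff] at h1 h2 <;> omega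
  have e1 := gmul_zero hG hH hd
  have e2 := gmul_zero hH hG (fun t h => hd t h.symm)
  have h3 : (G - 1) * (H - 1) - (H - 1) * (G - 1) = G * H - H * G := by noncomm_ring
  rw [e1, e2, sub_self] at h3
  exact (sub_eq_zero.mp h3.symm)

lemma QT_one {n : ℕ} (S : Finset (Fin (n + 1))) : QT S 1 = 1 := by
  ext i j
  simp [QT, Matrix.one_apply]

lemma QT_list {n : ℕ} (G : Fin n → Matrix (Fin (n + 1)) (Fin (n + 1)) ℂ)
    (hG : ∀ k : Fin n, IsGMat k (G k)) (S : Finset (Fin (n + 1))) (N : ℕ) :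
    ∀ l : List (Fin n), l.length = N → l.Nodup →
      (QT S (l.map G).prod).det = (l.map fun k => (QT S (G k)).det).prod := by
  induction N with
  | zero =>
    intro l hl _
    rw [List.length_eq_zero_iff] at hl
    subst hl
    simp [QT_one]
  | succ N ih =>
    intro l hl hnd
    have hne : l.toFinset.Nonempty := by
      rw [List.toFinset_nonempty_iff]; rintro rfl; simp at hl
    obtain ⟨m, hm, hmax⟩ := Finset.exists_max_image l.toFinset id hne
    obtain ⟨l1, l2, rfl⟩ := List.append_of_mem (List.mem_toFinset.mp hm)
    rw [List.nodup_middle, List.nodup_cons] at hnd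
    obtain ⟨hml, hnd⟩ := hnd
    have hlt : ∀ x ∈ l1 ++ l2, x < m := by
      intro x hx
      have h1 : x ≤ m := hmax x (by simp at hx ⊢; tauto)
      exact lt_of_le_of_ne h1 (fun h => hml (h ▸ hx))
    have ih' := ih (l1 ++ l2) (by simp at hl ⊢; omega) hnd
    have hfix : ∀ l' : List (Fin n), (∀ x ∈ l', x < m) → FixQ m.succ (l'.map G).prod := by
      intro l' h
      induction l' with
      | nil => simpa using FixQ.one _
      | cons a l' ih2 =>
        rw [List.map_cons, List.prod_cons]
        exact ((hG a).fixQ m (h a (by simp))).mul (ih2 fun x hx => h x (by simp [hx]))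
    have hF := hfix _ hlt
    have hcomm : ∀ l' : List (Fin n), (∀ x ∈ l', (x : ℕ) + 1 < m) →
        Commute (l'.map G).prod (G m) := by
      intro l' h
      apply Commute.list_prod_left
      intro x hx
      obtain ⟨a, ha, rfl⟩ := List.mem_map.mp hx
      exact gcommute (hG a) (hG m) (h a ha)
    have hsc : ((l1 ++ m :: l2).map fun k => (QT S (G k)).det).prod
        = ((l1 ++ l2).map fun k => (QT S (G k)).det).prod * (QT S (G m)).det := by
      simp only [List.map_append, List.map_cons, List.prod_append, List.prod_cons]
      ring
    rw [hsc, ← ih']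
    have hdis := (List.nodup_append.mp hnd).2.2
    by_cases h2 : ∀ x ∈ l2, (x : ℕ) + 1 < m
    · rw [← QT_mul S m _ _ (hG m) hF]
      congr 2
      simp only [List.map_append, List.map_cons, List.prod_append, List.prod_cons]
      rw [mul_assoc, (hcomm l2 h2).eq]
    · push Not at h2
      obtain ⟨y, hy, hym⟩ := h2
      have h1 : ∀ x ∈ l1, (x : ℕ) + 1 < m := by
        intro x hx
        have a1 : (x : ℕ) < m := hlt x (by simp [hx])
        have a2 : (y : ℕ) < m := hlt y (by simp [hy])
        have a3 := hdis x hx y hy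
        rw [Ne, Fin.ext_iff] at a3
        omega
      rw [← QT_mul' S m _ _ (hG m) hF]
      congr 2
      simp only [List.map_append, List.map_cons, List.prod_append, List.prod_cons]
      rw [← mul_assoc, ← mul_assoc, (hcomm l1 h1).eq]

lemma QT_Mperm {n : ℕ} (G : Fin n → Matrix (Fin (n + 1)) (Fin (n + 1)) ℂ)
    (hG : ∀ k : Fin n, IsGMat k (G k)) (S : Finset (Fin (n + 1))) (π : Equiv.Perm (Fin n)) :
    (QT S (Mperm G π)).det = ∏ k, (QT S (G k)).det := by
  have h := QT_list G hG S _ (List.ofFn π) rfl (List.nodup_ofFn.mpr π.injective)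
  rw [List.map_ofFn, List.map_ofFn, List.prod_ofFn] at h
  rw [← Equiv.prod_comp π]
  exact h

lemma det_piecewise {n : ℕ} (S : Finset (Fin (n + 1)))
    (M : Matrix (Fin (n + 1)) (Fin (n + 1)) ℂ) :
    Matrix.det (Matrix.of (S.piecewise M.row (1 : Matrix _ _ ℂ).row)) = (QT S M).det := by
  let E : Matrix (Fin (n + 1)) (Fin (n + 1)) ℂ := Matrix.diagonal fun i => if i ∈ S then 1 else 0
  have h1 : Matrix.of (S.piecewise M.row (1 : Matrix _ _ ℂ).row) = 1 + E * (E * (M - 1)) := by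
    ext i j
    by_cases hi : i ∈ S <;> simp [E, Matrix.diagonal_mul, hi, Finset.piecewise, Matrix.row]
  have h2 : QT S M = 1 + (E * (M - 1)) * E := by
    ext i j
    by_cases hi : i ∈ S <;> by_cases hj : j ∈ S <;>
      simp [E, Matrix.diagonal_mul, Matrix.mul_diagonal, hi, hj, QT, Matrix.one_apply]
  rw [h1, h2, Matrix.det_one_add_mul_comm]

lemma det_expand {n : ℕ} (a d : Fin (n + 1) → ℂ)
    (M : Matrix (Fin (n + 1)) (Fin (n + 1)) ℂ) :
    (Matrix.diagonal a * M + Matrix.diagonal d).det =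
      ∑ S : Finset (Fin (n + 1)), (∏ i, S.piecewise a d i) * (QT S M).det := by
  have h := (Matrix.detRowAlternating (R := ℂ) (n := Fin (n + 1))).toMultilinearMap.map_add_univ
    (fun i => a i • M i) (fun i => d i • (1 : Matrix _ _ ℂ) i)
  have e : (Matrix.diagonal a * M + Matrix.diagonal d) =
      Matrix.of ((fun i => a i • M i) + (fun i => d i • (1 : Matrix _ _ ℂ) i)) := by
    ext i j
    simp [Matrix.diagonal_mul, Matrix.diagonal_apply, Matrix.one_apply]
  rw [e]
  refine h.trans (Finset.sum_congr rfl fun S _ => ?_)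
  rw [← det_piecewise, ← smul_eq_mul]
  have h2 := (Matrix.detRowAlternating (R := ℂ) (n := Fin (n + 1))).toMultilinearMap.map_smul_univ
    (S.piecewise a d) (S.piecewise M.row (1 : Matrix _ _ ℂ).row)
  refine Eq.trans ?_ h2
  congr 1
  ext i j
  by_cases hi : i ∈ S <;> simp [hi, Finset.piecewise, Matrix.row]

lemma Pproj_sub {n : ℕ} (X : Matrix (Fin (n + 1)) (Fin (n + 1)) ℂ) :
    Pproj n * X * (Pproj n)ᴴ = X.submatrix Fin.castSucc Fin.castSucc := by
  have hP : ∀ (i : Fin n) (j : Fin (n + 1)), Pproj n i j = if j = i.castSucc then 1 else 0 := by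
    intro i j
    simp [Pproj, Fin.ext_iff]
  ext i j
  simp [Matrix.mul_apply, hP, apply_ite]

lemma det_proj {n : ℕ} (a d : Fin (n + 1) → ℂ)
    (M : Matrix (Fin (n + 1)) (Fin (n + 1)) ℂ) :
    (Pproj n * (Matrix.diagonal a * M + Matrix.diagonal d) * (Pproj n)ᴴ).det =
      (Matrix.diagonal (Function.update a (Fin.last n) 0) * M +
        Matrix.diagonal (Function.update d (Fin.last n) 1)).det := by
  rw [Pproj_sub, Matrix.det_succ_row _ (Fin.last n), Finset.sum_eq_single (Fin.last n)]
  · have : ((-1 : ℂ)) ^ (n + n) = 1 := Even.neg_one_pow ⟨n, rfl⟩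
    simp only [Fin.val_last, this, Matrix.add_apply, Matrix.diagonal_mul, Matrix.diagonal_apply_eq,
      Function.update_self, zero_mul, zero_add, one_mul]
    congr 1
    ext i j
    have hi : i.castSucc ≠ Fin.last n := (Fin.castSucc_lt_last i).ne
    simp [Matrix.diagonal_mul, Matrix.diagonal_apply, hi]
  · intro b _ hb
    simp [Matrix.diagonal_mul, Matrix.diagonal_apply, hb.symm]
  · simp

/-- Theorem `thmAMPD3`: for any permutation π of (1,…,n), G-matrices
G_1,…,G_n, diagonal matrices A, D and the projection P = [I_n 0],
det(P(A·M_π + D)P^*) does not depend on π. -/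
theorem stmt17 (n : ℕ) (G : Fin n → Matrix (Fin (n + 1)) (Fin (n + 1)) ℂ)
    (hG : ∀ k : Fin n, IsGMat k (G k))
    (A D : Matrix (Fin (n + 1)) (Fin (n + 1)) ℂ) (hA : A.IsDiag) (hD : D.IsDiag)
    (π₁ π₂ : Equiv.Perm (Fin n)) :
    (Pproj n * (A * Mperm G π₁ + D) * (Pproj n)ᴴ).det =
      (Pproj n * (A * Mperm G π₂ + D) * (Pproj n)ᴴ).det := by
  rw [← hA.diagonal_diag, ← hD.diagonal_diag, det_proj, det_proj, det_expand, det_expand]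
  refine Finset.sum_congr rfl fun S _ => ?_
  rw [QT_Mperm G hG, QT_Mperm G hG]
end
end
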